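/- For every constant ε > 0 there exists a constant c > 1 such that for every sufficiently large n there exists a function anmExt : {0,1}^n → {0,1} with the following property: for any affine source X on {0,1}^n of entropy at least c·log n and any affine tampering function 𝒜 : F₂^n → F₂^n without fixed points, it holds that (anmExt(X), anmExt(𝒜(X))) ≈_ε (U₁, anmExt(𝒜(X))). -/

import Mathlib

open scoped Classical

/-- Statistical distance between two PMFs on a finite type. -/
noncomputable def statDist {α : Type*} [Fintype α] (p q : PMF α) : ℝ :=
  (1/2) * ∑ a, |(p a).toReal - (q a).toReal|

/-- Product of two independent PMFs. -/
noncomputable def prodPMF {α β : Type*} (p : PMF α) (q : PMF β) : PMF (α × β) :=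
  p.bind fun a => q.map fun b => (a, b)

/-- The uniform distribution over the affine subspace `b + V` of `F₂ⁿ`:
an affine source of entropy `dim V`. -/
noncomputable def affinePMF {n : ℕ} (V : Submodule (ZMod 2) (Fin n → ZMod 2))
    (b : Fin n → ZMod 2) : PMF (Fin n → ZMod 2) :=
  letI : Fintype V := Fintype.ofFinite V
  haveI : Nonempty V := ⟨0⟩
  (PMF.uniformOfFintype V).map fun v => b + (v : Fin n → ZMod 2)

/-- The sign `(-1)^b` of a bit. -/
def bitSign (b : Bool) : ℝ := if b then -1 else 1

lemma bitSign_xor (a b : Bool) : bitSign (xor a b) = bitSign a * bitSign b := by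
  cases a <;> cases b <;> simp [bitSign]

lemma prodPMF_apply {α β : Type*} (p : PMF α) (q : PMF β) (a : α) (b : β) :
    prodPMF p q (a, b) = p a * q b := by
  have h (a' : α) : (q.map fun b' => (a', b')) (a, b) = if a' = a then q b else 0 := by
    rw [PMF.map_apply]
    split_ifs with h
    · subst h
      rw [tsum_eq_single b (by intro b' hb'; simp [hb'.symm])]
      simp
    · simp [Ne.symm h]
  simp only [prodPMF, PMF.bind_apply, h]
  rw [tsum_eq_single a (by intro a' ha'; simp [ha'])]
  simp

lemma toReal_map_uniformOfFintype {Ω α : Type*} [Fintype Ω] [Nonempty Ω] [DecidableEq α]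
    (g : Ω → α) (y : α) :
    (((PMF.uniformOfFintype Ω).map g) y).toReal =
      (Fintype.card Ω : ℝ)⁻¹ * ∑ v, if g v = y then (1 : ℝ) else 0 := by
  rw [PMF.map_apply, tsum_fintype, ENNReal.toReal_sum, Finset.mul_sum]
  · refine Finset.sum_congr rfl fun v _ => ?_
    by_cases h : g v = y
    · simp [h]
    · simp [h, Ne.symm h]
  · intro v _
    split_ifs <;> simp

/-- Fourier bound for the distance of a pair of bits from a uniform bit paired with an
independent copy of the second one. -/
lemma statDist_pair_le {Ω : Type*} [Fintype Ω] [Nonempty Ω] (u w : Ω → Bool) :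
    statDist ((PMF.uniformOfFintype Ω).map fun v => (u v, w v))
      (prodPMF (PMF.uniformOfFintype Bool) ((PMF.uniformOfFintype Ω).map w)) ≤
    (Fintype.card Ω : ℝ)⁻¹ *
      ((|∑ v, bitSign (u v)| + |∑ v, bitSign (u v) * bitSign (w v)|) / 2) := by
  have key (a b : Bool) :
      |(((PMF.uniformOfFintype Ω).map fun v => (u v, w v)) (a, b)).toReal -
        (prodPMF (PMF.uniformOfFintype Bool) ((PMF.uniformOfFintype Ω).map w) (a, b)).toReal| ≤
      (Fintype.card Ω : ℝ)⁻¹ *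
        ((|∑ v, bitSign (u v)| + |∑ v, bitSign (u v) * bitSign (w v)|) / 4) := by
    rw [prodPMF_apply, ENNReal.toReal_mul, toReal_map_uniformOfFintype,
      toReal_map_uniformOfFintype]
    have hsum : (∑ v, if (u v, w v) = (a, b) then (1 : ℝ) else 0) -
        1 / 2 * (∑ v, if w v = b then (1 : ℝ) else 0) =
        bitSign a / 4 * (∑ v, bitSign (u v) +
          bitSign b * ∑ v, bitSign (u v) * bitSign (w v)) := by
      simp only [Finset.mul_sum, ← Finset.sum_sub_distrib, ← Finset.sum_add_distrib]
      refine Finset.sum_congr rfl fun v _ => ?_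
      generalize u v = p
      generalize w v = q
      cases a <;> cases b <;> cases p <;> cases q <;> norm_num [bitSign]
    have hhalf : (PMF.uniformOfFintype Bool a).toReal = 1 / 2 := by simp
    have h : (Fintype.card Ω : ℝ)⁻¹ * (∑ v, if (u v, w v) = (a, b) then (1 : ℝ) else 0) -
        (PMF.uniformOfFintype Bool a).toReal *
          ((Fintype.card Ω : ℝ)⁻¹ * ∑ v, if w v = b then (1 : ℝ) else 0) =
        (Fintype.card Ω : ℝ)⁻¹ * (bitSign a / 4 * (∑ v, bitSign (u v) +
          bitSign b * ∑ v, bitSign (u v) * bitSign (w v))) := by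
      rw [hhalf]
      linear_combination (Fintype.card Ω : ℝ)⁻¹ * hsum
    rw [h, abs_mul, abs_of_nonneg (by positivity : (0 : ℝ) ≤ (Fintype.card Ω : ℝ)⁻¹)]
    refine mul_le_mul_of_nonneg_left ?_ (by positivity)
    have ha : |bitSign a / 4| = 1 / 4 := by cases a <;> norm_num [bitSign, abs_div]
    have hb : |bitSign b| = 1 := by cases b <;> norm_num [bitSign]
    rw [abs_mul, ha]
    have := abs_add_le (∑ v, bitSign (u v)) (bitSign b * ∑ v, bitSign (u v) * bitSign (w v))
    rw [abs_mul, hb, one_mul] at this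
    linarith
  unfold statDist
  have := Finset.sum_le_sum fun (p : Bool × Bool) (_ : p ∈ Finset.univ) => key p.1 p.2
  rw [Finset.sum_const] at this
  simp only [Finset.card_univ, Fintype.card_prod, Fintype.card_bool, nsmul_eq_mul] at this
  push_cast at this
  linarith

section RandomFunction

variable {Z : Type*} [Fintype Z]

lemma sum_exp_bitSign (S : Finset Z) (t : ℝ) :
    ∑ f : Z → Bool, Real.exp (t * ∑ x ∈ S, bitSign (f x)) =
      2 ^ Fintype.card Z * Real.cosh t ^ S.card := by
  have h (f : Z → Bool) : Real.exp (t * ∑ x ∈ S, bitSign (f x)) =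
      ∏ x, if x ∈ S then Real.exp (t * bitSign (f x)) else 1 := by
    rw [Finset.mul_sum, Real.exp_sum, Finset.prod_ite_mem, Finset.univ_inter]
  have h2 (x : Z) : (∑ b : Bool, if x ∈ S then Real.exp (t * bitSign b) else 1) =
      2 * if x ∈ S then Real.cosh t else 1 := by
    split_ifs
    · rw [Real.cosh_eq]; simp [bitSign]; ring
    · simp
  simp_rw [h]
  rw [← Fintype.piFinset_univ, Finset.sum_prod_piFinset Finset.univ
    (fun (x : Z) (b : Bool) => if x ∈ S then Real.exp (t * bitSign b) else 1)]
  simp_rw [h2]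
  rw [Finset.prod_mul_distrib, Finset.prod_ite_mem]
  simp

/-- Hoeffding's bound for a sum of random signs, in counting form. -/
lemma card_bitSign_sum_gt_le (S : Finset Z) {t R : ℝ} (ht : 0 ≤ t) (hR : S.card ≤ R) :
    ((Finset.univ.filter fun f : Z → Bool => t * R < |∑ x ∈ S, bitSign (f x)|).card : ℝ) ≤
      2 * Real.exp (-(t ^ 2 * R / 2)) * 2 ^ Fintype.card Z := by
  have hcosh : Real.cosh t ^ S.card ≤ Real.exp (t ^ 2 * R / 2) := by
    calc Real.cosh t ^ S.card ≤ Real.exp (t ^ 2 / 2) ^ S.card :=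
          pow_le_pow_left₀ (Real.cosh_pos t).le (Real.cosh_le_exp_half_sq t) _
      _ = Real.exp (S.card * (t ^ 2 / 2)) := (Real.exp_nat_mul _ _).symm
      _ ≤ _ := Real.exp_le_exp.mpr (by nlinarith [sq_nonneg t])
  have hmom : ∑ f : Z → Bool, (Real.exp (t * ∑ x ∈ S, bitSign (f x)) +
      Real.exp (-t * ∑ x ∈ S, bitSign (f x))) ≤
      2 * Real.exp (t ^ 2 * R / 2) * 2 ^ Fintype.card Z := by
    rw [Finset.sum_add_distrib, sum_exp_bitSign, sum_exp_bitSign, Real.cosh_neg]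
    have := mul_le_mul_of_nonneg_left hcosh
      (by positivity : (0 : ℝ) ≤ 2 ^ Fintype.card Z)
    linarith
  have hmarkov : ((Finset.univ.filter fun f : Z → Bool =>
      t * R < |∑ x ∈ S, bitSign (f x)|).card : ℝ) * Real.exp (t ^ 2 * R) ≤
      ∑ f : Z → Bool, (Real.exp (t * ∑ x ∈ S, bitSign (f x)) +
        Real.exp (-t * ∑ x ∈ S, bitSign (f x))) := by
    rw [← nsmul_eq_mul, ← Finset.sum_const]
    refine (Finset.sum_le_sum fun f hf => ?_).trans
      (Finset.sum_le_sum_of_subset_of_nonneg (Finset.filter_subset _ _) fun _ _ _ => by positivity)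
    have hf' := (Finset.mem_filter.mp hf).2
    rcases le_total 0 (∑ x ∈ S, bitSign (f x)) with h | h
    · rw [abs_of_nonneg h] at hf'
      have : Real.exp (t ^ 2 * R) ≤ Real.exp (t * ∑ x ∈ S, bitSign (f x)) :=
        Real.exp_le_exp.mpr (by nlinarith)
      linarith [Real.exp_pos (-t * ∑ x ∈ S, bitSign (f x))]
    · rw [abs_of_nonpos h] at hf'
      have : Real.exp (t ^ 2 * R) ≤ Real.exp (-t * ∑ x ∈ S, bitSign (f x)) :=
        Real.exp_le_exp.mpr (by nlinarith)
      linarith [Real.exp_pos (t * ∑ x ∈ S, bitSign (f x))]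
  refine le_of_mul_le_mul_right (hmarkov.trans (hmom.trans_eq ?_)) (Real.exp_pos (t ^ 2 * R))
  have : Real.exp (t ^ 2 * R / 2) = Real.exp (-(t ^ 2 * R / 2)) * Real.exp (t ^ 2 * R) := by
    rw [← Real.exp_add]; congr 1; ring
  rw [this]; ring

/-- Hoeffding's bound for correlations of a random function with a shift of itself that moves
`S` off itself: a measure-preserving involution reduces it to the sum of signs. -/
lemma card_bitSign_corr_gt_le (S : Finset Z) (τ : Z → Z) (hτ : ∀ x ∈ S, τ x ∉ S) {t R : ℝ}
    (ht : 0 ≤ t) (hR : S.card ≤ R) :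
    ((Finset.univ.filter fun f : Z → Bool =>
      t * R < |∑ x ∈ S, bitSign (f x) * bitSign (f (τ x))|).card : ℝ) ≤
      2 * Real.exp (-(t ^ 2 * R / 2)) * 2 ^ Fintype.card Z := by
  refine le_trans ?_ (card_bitSign_sum_gt_le S ht hR)
  let φ : (Z → Bool) → Z → Bool := fun f z => if z ∈ S then xor (f z) (f (τ z)) else f z
  have hφ : Function.Involutive φ := by
    intro f
    funext z
    by_cases hz : z ∈ S
    · simp [φ, hz, hτ z hz]
    · simp [φ, hz]
  norm_cast
  refine Finset.card_le_card_of_injOn φ (fun f hf => ?_) hφ.injective.injOn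
  have hsum : ∑ x ∈ S, bitSign (φ f x) = ∑ x ∈ S, bitSign (f x) * bitSign (f (τ x)) :=
    Finset.sum_congr rfl fun x hx => by simp only [φ, hx, if_true, bitSign_xor]
  simpa [hsum] using hf

/-- A family of tests, few compared to their sizes, is passed simultaneously by some function. -/
lemma exists_bitSign_sum_corr_le {I : Type*} [Fintype I] (S : I → Finset Z) (τ : I → Z → Z)
    (R : I → ℝ) {t r : ℝ} (ht : 0 ≤ t) (hτ : ∀ i, ∀ x ∈ S i, τ i x ∉ S i)
    (hS : ∀ i, (S i).card ≤ R i) (hR : ∀ i, r ≤ R i)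
    (hI : 4 * (Fintype.card I : ℝ) * Real.exp (-(t ^ 2 * r / 2)) < 1) :
    ∃ f : Z → Bool, ∀ i, |∑ x ∈ S i, bitSign (f x)| ≤ t * R i ∧
      |∑ x ∈ S i, bitSign (f x) * bitSign (f (τ i x))| ≤ t * R i := by
  by_contra! hcon
  let B : I → Finset (Z → Bool) := fun i =>
    (Finset.univ.filter fun f : Z → Bool => t * R i < |∑ x ∈ S i, bitSign (f x)|) ∪
    (Finset.univ.filter fun f : Z → Bool =>
      t * R i < |∑ x ∈ S i, bitSign (f x) * bitSign (f (τ i x))|)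
  have hB (i : I) : ((B i).card : ℝ) ≤
      4 * Real.exp (-(t ^ 2 * r / 2)) * 2 ^ Fintype.card Z := by
    have h0 : ((B i).card : ℝ) ≤
        (Finset.univ.filter fun f : Z → Bool => t * R i < |∑ x ∈ S i, bitSign (f x)|).card +
        (Finset.univ.filter fun f : Z → Bool =>
          t * R i < |∑ x ∈ S i, bitSign (f x) * bitSign (f (τ i x))|).card := by
      exact_mod_cast Finset.card_union_le _ _
    have h1 := card_bitSign_sum_gt_le (S i) ht (hS i)
    have h2 := card_bitSign_corr_gt_le (S i) (τ i) (hτ i) ht (hS i)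
    have h3 : Real.exp (-(t ^ 2 * R i / 2)) ≤ Real.exp (-(t ^ 2 * r / 2)) :=
      Real.exp_le_exp.mpr (by nlinarith [mul_le_mul_of_nonneg_left (hR i) (sq_nonneg t)])
    have h4 := mul_le_mul_of_nonneg_right h3 (by positivity : (0 : ℝ) ≤ 2 ^ Fintype.card Z)
    linarith
  have hcover : (Finset.univ : Finset (Z → Bool)) ⊆ Finset.univ.biUnion B := by
    intro f _
    obtain ⟨i, hi⟩ := hcon f
    refine Finset.mem_biUnion.mpr ⟨i, Finset.mem_univ _, ?_⟩
    simp only [B, Finset.mem_union, Finset.mem_filter, Finset.mem_univ, true_and]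
    by_cases h : t * R i < |∑ x ∈ S i, bitSign (f x)|
    · exact Or.inl h
    · exact Or.inr (hi (not_lt.mp h))
  have h1 : (2 : ℝ) ^ Fintype.card Z ≤ ∑ i, ((B i).card : ℝ) := by
    have := (Finset.card_le_card hcover).trans Finset.card_biUnion_le
    rw [Finset.card_univ, Fintype.card_fun, Fintype.card_bool] at this
    exact_mod_cast this
  have h2 := h1.trans (Finset.sum_le_sum fun i _ => hB i)
  rw [Finset.sum_const, Finset.card_univ, nsmul_eq_mul] at h2
  have h3 := mul_lt_mul_of_pos_right hI (by positivity : (0 : ℝ) < 2 ^ Fintype.card Z)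
  linarith

end RandomFunction

lemma card_submodule_le_card_end {K E : Type*} [Field K] [AddCommGroup E] [Module K E]
    [Finite (E →ₗ[K] E)] : Nat.card (Submodule K E) ≤ Nat.card (E →ₗ[K] E) := by
  refine Nat.card_le_card_of_surjective (fun P : E →ₗ[K] E => LinearMap.range P) fun V => ?_
  obtain ⟨W, hW⟩ := V.exists_isCompl
  exact ⟨V.subtype ∘ₗ V.projectionOnto W hW, by
    simp [LinearMap.range_comp]⟩

/-- A fixed-point-free affine map changes the value of some linear functional everywhere. -/
lemma exists_dual_apply_ne {K E : Type*} [Field K] [AddCommGroup E] [Module K E]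
    (M : E →ₗ[K] E) (c : E) (h : ∀ x, M x + c ≠ x) :
    ∃ ℓ : Module.Dual K E, ∀ x, ℓ (M x + c) ≠ ℓ x := by
  have hc : c ∉ LinearMap.range (LinearMap.id - M) := by
    rintro ⟨x, hx⟩
    exact h x (by rw [← hx]; simp)
  obtain ⟨ℓ, hℓc, hℓ⟩ := Submodule.exists_le_ker_of_notMem hc
  refine ⟨ℓ, fun x hx => hℓc ?_⟩
  have h1 : ℓ (x - M x) = 0 := hℓ ⟨x, by simp⟩
  rw [map_add] at hx
  rw [map_sub] at h1
  linear_combination hx + h1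

/-- The points of the affine subspace `b + V` on which `ℓ` takes the value `a`. -/
noncomputable def affineSlice {n : ℕ} (V : Submodule (ZMod 2) (Fin n → ZMod 2))
    (b : Fin n → ZMod 2) (ℓ : Module.Dual (ZMod 2) (Fin n → ZMod 2)) (a : ZMod 2) :
    Finset (Fin n → ZMod 2) :=
  Finset.univ.filter fun x => x - b ∈ V ∧ ℓ x = a

section AffineSlice

variable {n : ℕ} (V : Submodule (ZMod 2) (Fin n → ZMod 2)) [Fintype V] (b : Fin n → ZMod 2)
  (ℓ : Module.Dual (ZMod 2) (Fin n → ZMod 2))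

lemma sum_affineSlice (F : (Fin n → ZMod 2) → ℝ) :
    ∑ a, ∑ x ∈ affineSlice V b ℓ a, F x = ∑ v : V, F (b + v) := by
  have h (a : ZMod 2) : affineSlice V b ℓ a =
      (Finset.univ.filter fun x => x - b ∈ V).filter fun x => ℓ x = a := by
    rw [affineSlice, Finset.filter_filter]
  simp_rw [h]
  rw [Finset.sum_fiberwise]
  symm
  refine Finset.sum_bij (fun v _ => b + (v : Fin n → ZMod 2)) ?_ ?_ ?_ ?_
  · intro v _
    simp
  · intro v _ w _ h
    exact Subtype.ext (add_left_cancel h)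
  · intro x hx
    exact ⟨⟨x - b, (Finset.mem_filter.mp hx).2⟩, Finset.mem_univ _, by simp⟩
  · intro v _
    rfl

lemma card_affineSlice_le (a : ZMod 2) : (affineSlice V b ℓ a).card ≤ Fintype.card V := by
  have h := sum_affineSlice V b ℓ fun _ => 1
  have h1 := Finset.single_le_sum (f := fun a => ∑ _x ∈ affineSlice V b ℓ a, (1 : ℝ))
    (fun _ _ => by positivity) (Finset.mem_univ a)
  rw [h] at h1
  simpa using h1

lemma abs_sum_affine_le {F : (Fin n → ZMod 2) → ℝ} {B : ℝ}
    (h : ∀ a, |∑ x ∈ affineSlice V b ℓ a, F x| ≤ B) : |∑ v : V, F (b + v)| ≤ 2 * B := by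
  rw [← sum_affineSlice V b ℓ F]
  refine (Finset.abs_sum_le_sum_abs _ _).trans ((Finset.sum_le_sum fun a _ => h a).trans ?_)
  simp [ZMod.card]

end AffineSlice

lemma card_affine_tests_le (n : ℕ) :
    Nat.card ((Submodule (ZMod 2) (Fin n → ZMod 2) × (Fin n → ZMod 2)) ×
      (((Fin n → ZMod 2) →ₗ[ZMod 2] (Fin n → ZMod 2)) × (Fin n → ZMod 2)) ×
      (Module.Dual (ZMod 2) (Fin n → ZMod 2) × ZMod 2)) ≤ 2 ^ (2 * n ^ 2 + 3 * n + 1) := by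
  have hE : Nat.card (Fin n → ZMod 2) = 2 ^ n := by simp [Nat.card_eq_fintype_card]
  have hL : Nat.card ((Fin n → ZMod 2) →ₗ[ZMod 2] (Fin n → ZMod 2)) = 2 ^ (n ^ 2) := by
    rw [Module.natCard_eq_pow_finrank (K := ZMod 2), Module.finrank_linearMap]
    simp [sq]
  have hD : Nat.card (Module.Dual (ZMod 2) (Fin n → ZMod 2)) = 2 ^ n := by
    rw [Module.natCard_eq_pow_finrank (K := ZMod 2), Subspace.dual_finrank_eq]
    simp
  have : Finite ((Fin n → ZMod 2) →ₗ[ZMod 2] (Fin n → ZMod 2)) :=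
    Module.finite_of_finite (ZMod 2)
  have hV : Nat.card (Submodule (ZMod 2) (Fin n → ZMod 2)) ≤ 2 ^ (n ^ 2) :=
    card_submodule_le_card_end.trans_eq hL
  simp only [Nat.card_prod, hE, hL, hD, Nat.card_zmod]
  calc _ ≤ 2 ^ n ^ 2 * 2 ^ n * (2 ^ n ^ 2 * 2 ^ n * (2 ^ n * 2)) := by gcongr
    _ = _ := by ring

lemma four_mul_two_pow_mul_exp_lt_one {n : ℕ} {δ : ℝ} (hn : 1 ≤ n) (hδ : 0 < δ)
    (h : 16 / δ ^ 2 < n) :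
    4 * (2 : ℝ) ^ (2 * n ^ 2 + 3 * n + 1) * Real.exp (-(δ ^ 2 * (n : ℝ) ^ 3 / 2)) < 1 := by
  have hn' : (1 : ℝ) ≤ n := by exact_mod_cast hn
  have h2 : (2 : ℝ) ≤ Real.exp 1 := by linarith [Real.add_one_le_exp 1]
  have hpow : 4 * (2 : ℝ) ^ (2 * n ^ 2 + 3 * n + 1) ≤
      Real.exp (2 * (n : ℝ) ^ 2 + 3 * n + 3) := by
    calc 4 * (2 : ℝ) ^ (2 * n ^ 2 + 3 * n + 1) = 2 ^ (2 * n ^ 2 + 3 * n + 3) := by ring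
      _ ≤ Real.exp 1 ^ (2 * n ^ 2 + 3 * n + 3) := pow_le_pow_left₀ (by norm_num) h2 _
      _ = _ := by rw [← Real.exp_nat_mul]; push_cast; ring_nf
  refine (mul_le_mul_of_nonneg_right hpow (Real.exp_pos _).le).trans_lt ?_
  rw [← Real.exp_add, Real.exp_lt_one_iff]
  have h16 : 16 < δ ^ 2 * n := by
    rw [div_lt_iff₀ (by positivity)] at h
    linarith
  nlinarith [mul_lt_mul_of_pos_right h16 (by positivity : (0 : ℝ) < (n : ℝ) ^ 2)]

lemma affinePMF_map {n : ℕ} (V : Submodule (ZMod 2) (Fin n → ZMod 2)) (b : Fin n → ZMod 2)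
    {α : Type} (g : (Fin n → ZMod 2) → α) :
    letI : Fintype V := Fintype.ofFinite V
    (affinePMF V b).map g = (PMF.uniformOfFintype V).map fun v : V => g (b + v) := by
  let : Fintype V := Fintype.ofFinite V
  change (((PMF.uniformOfFintype V).map fun v : V => (v : Fin n → ZMod 2)).map
    fun x => b + x).map g = _
  rw [PMF.map_comp, PMF.map_comp]
  rfl

/-- Affine non-malleable extractors for entropy `O(log n)` with constant error
and one output bit. -/
theorem affine_nm_ext_logarithmic :
    ∀ ε : ℝ, 0 < ε → ∃ c > (1 : ℝ), ∀ᶠ n : ℕ in Filter.atTop,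
      ∃ ext : (Fin n → ZMod 2) → Bool,
        ∀ (V : Submodule (ZMod 2) (Fin n → ZMod 2)) (b : Fin n → ZMod 2),
          c * Real.logb 2 n ≤ (Module.finrank (ZMod 2) V : ℝ) →
          ∀ (M : (Fin n → ZMod 2) →ₗ[ZMod 2] (Fin n → ZMod 2)) (c₀ : Fin n → ZMod 2),
            (∀ x, M x + c₀ ≠ x) →
            statDist
              ((affinePMF V b).map fun x => (ext x, ext (M x + c₀)))
              (prodPMF (PMF.uniformOfFintype Bool)
                ((affinePMF V b).map fun x => ext (M x + c₀)))
              ≤ ε := by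
  intro ε hε
  refine ⟨3, by norm_num, ?_⟩
  have hδ : 0 < ε / 2 := by positivity
  filter_upwards [Filter.eventually_ge_atTop 1,
    tendsto_natCast_atTop_atTop.eventually_gt_atTop (16 / (ε / 2) ^ 2)] with n hn hbig
  have hn0 : (0 : ℝ) < n := by exact_mod_cast hn
  let J := (Submodule (ZMod 2) (Fin n → ZMod 2) × (Fin n → ZMod 2)) ×
      (((Fin n → ZMod 2) →ₗ[ZMod 2] (Fin n → ZMod 2)) × (Fin n → ZMod 2)) ×
      (Module.Dual (ZMod 2) (Fin n → ZMod 2) × ZMod 2)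
  let I := {j : J // (n : ℝ) ^ 3 ≤ Nat.card j.1.1 ∧
    ∀ x, j.2.2.1 (j.2.1.1 x + j.2.1.2) ≠ j.2.2.1 x}
  have : Finite ((Fin n → ZMod 2) →ₗ[ZMod 2] (Fin n → ZMod 2)) :=
    Module.finite_of_finite (ZMod 2)
  have : Finite (Module.Dual (ZMod 2) (Fin n → ZMod 2)) :=
    Module.finite_of_finite (ZMod 2)
  have : Finite J := inferInstance
  let : Fintype I := Fintype.ofFinite I
  have hI : (Fintype.card I : ℝ) ≤ 2 ^ (2 * n ^ 2 + 3 * n + 1) := by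
    rw [Fintype.card_eq_nat_card]
    exact_mod_cast (Finite.card_subtype_le _).trans (card_affine_tests_le n)
  obtain ⟨ext, hext⟩ := exists_bitSign_sum_corr_le (I := I) (t := ε / 2) (r := (n : ℝ) ^ 3)
    (fun i => affineSlice i.1.1.1 i.1.1.2 i.1.2.2.1 i.1.2.2.2)
    (fun i x => i.1.2.1.1 x + i.1.2.1.2) (fun i => Nat.card i.1.1.1) hδ.le
    (by
      rintro ⟨⟨⟨V, b⟩, ⟨M, c₀⟩, ℓ, a⟩, hi⟩ x hx hx'
      exact hi.2 x ((Finset.mem_filter.mp hx').2.2.trans (Finset.mem_filter.mp hx).2.2.symm))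
    (by
      rintro ⟨⟨⟨V, b⟩, ⟨M, c₀⟩, ℓ, a⟩, hi⟩
      let : Fintype V := Fintype.ofFinite V
      rw [Nat.card_eq_fintype_card]
      exact_mod_cast card_affineSlice_le V b ℓ a)
    (fun i => i.2.1)
    ((by gcongr : _ ≤ _).trans_lt (four_mul_two_pow_mul_exp_lt_one hn hδ hbig))
  refine ⟨ext, fun V b hV M c₀ hfix => ?_⟩
  obtain ⟨ℓ, hℓ⟩ := exists_dual_apply_ne M c₀ hfix
  let : Fintype V := Fintype.ofFinite V
  have : Nonempty V := ⟨0⟩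
  have hcard : (n : ℝ) ^ 3 ≤ Nat.card V := by
    rw [Module.natCard_eq_pow_finrank (K := ZMod 2), Nat.card_zmod]
    push_cast
    rw [← Real.rpow_natCast 2, ← Real.logb_le_iff_le_rpow (by norm_num) (by positivity),
      Real.logb_pow]
    exact_mod_cast hV
  have htest (a : ZMod 2) := hext ⟨⟨⟨V, b⟩, ⟨M, c₀⟩, ℓ, a⟩, hcard, hℓ⟩
  have h1 := abs_sum_affine_le V b ℓ (F := fun x => bitSign (ext x))
    (B := ε / 2 * Nat.card V) fun a => (htest a).1
  have h2 := abs_sum_affine_le V b ℓ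
    (F := fun x => bitSign (ext x) * bitSign (ext (M x + c₀)))
    (B := ε / 2 * Nat.card V) fun a => (htest a).2
  have hdist := statDist_pair_le (fun v : V => ext (b + v)) fun v : V => ext (M (b + v) + c₀)
  rw [affinePMF_map, affinePMF_map]
  refine hdist.trans ?_
  have hpos : (0 : ℝ) < Fintype.card V := by exact_mod_cast Fintype.card_pos
  rw [Nat.card_eq_fintype_card] at h1 h2
  rw [inv_mul_le_iff₀ hpos]
  linarith
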